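/- Derivation of the first inequality of Theorem 1: Let S, T, K, W, U, Ŷ2, Y11, Y12 be random variables with K = α∘S = β∘T almost surely for some functions α, β. Suppose there exist real numbers ρ0, ρ1, r2 with r2 ≥ 0, ρ0 > I[(S,T):W|K], ρ1 > I[T:U|(S,W)], and H[S|(K,W)] + H[K] ≤ I[(S,U,W):(Ŷ2,Y11,Y12)] − r2 − ρ0 − ρ1. Then H[S] < I[(S,W,U):(Ŷ2,Y11,Y12)] − I[T:(W,U)|S]. -/

import Mathlib

open MeasureTheory

namespace JSCC

variable {Ω : Type*} [MeasurableSpace Ω]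

/-- Shannon entropy (natural log) of a finite-valued random variable. -/
noncomputable def H {A : Type*} [Fintype A] (μ : Measure Ω) (X : Ω → A) : ℝ :=
  ∑ a : A, Real.negMulLog (μ (X ⁻¹' {a})).toReal

/-- The pair of two random variables. -/
def p2 {A B : Type*} (X : Ω → A) (Y : Ω → B) : Ω → A × B := fun ω => (X ω, Y ω)

/-- The triple of three random variables. -/
def p3 {A B C : Type*} (X : Ω → A) (Y : Ω → B) (Z : Ω → C) : Ω → A × B × C :=
  fun ω => (X ω, Y ω, Z ω)

/-- Conditional entropy `H[X|Y]`. -/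
noncomputable def cH {A B : Type*} [Fintype A] [Fintype B] (μ : Measure Ω)
    (X : Ω → A) (Y : Ω → B) : ℝ :=
  H μ (p2 X Y) - H μ Y

/-- Mutual information `I[X:Y]`. -/
noncomputable def I {A B : Type*} [Fintype A] [Fintype B] (μ : Measure Ω)
    (X : Ω → A) (Y : Ω → B) : ℝ :=
  H μ X + H μ Y - H μ (p2 X Y)

/-- Conditional mutual information `I[X:Y|Z]`. -/
noncomputable def cI {A B C : Type*} [Fintype A] [Fintype B] [Fintype C] (μ : Measure Ω)
    (X : Ω → A) (Y : Ω → B) (Z : Ω → C) : ℝ :=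
  H μ (p2 X Z) + H μ (p2 Y Z) - H μ (p2 X (p2 Y Z)) - H μ Z

end JSCC

open JSCC

namespace JSCC

/-- Entropy is invariant under almost sure injective relabelling. -/
theorem H_eq_of_ae_eq_comp {Ω A B : Type*} [MeasurableSpace Ω] [Fintype A] [Fintype B]
    {μ : Measure Ω} {X : Ω → A} {Y : Ω → B} (f : A → B) (hf : Function.Injective f)
    (h : ∀ᵐ ω ∂μ, Y ω = f (X ω)) : H μ Y = H μ X := by
  have key : ∀ b, μ (Y ⁻¹' {b}) = μ ((fun ω => f (X ω)) ⁻¹' {b}) := fun b =>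
    measure_congr <| by
      filter_upwards [h] with ω hω
      exact congrArg (· = b) hω
  refine (Fintype.sum_of_injective f hf _ _ (fun b hb => ?_) (fun a => ?_)).symm
  · have hempty : (fun ω => f (X ω)) ⁻¹' {b} = ∅ :=
      Set.eq_empty_of_forall_notMem fun ω hω => hb ⟨X ω, hω⟩
    rw [key, hempty]
    simp
  · have hpre : (fun ω => f (X ω)) ⁻¹' {f a} = X ⁻¹' {a} :=
      Set.ext fun ω => hf.eq_iff
    rw [key, hpre]

end JSCC

/-- Derivation of the first inequality of Theorem 1. -/
theorem first_inequality_of_theorem_one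
    {Ω 𝒮 𝒯 𝒦 𝒲 𝒰 𝒵₂ 𝒴₁₁ 𝒴₁₂ : Type*}
    [MeasurableSpace Ω]
    [Fintype 𝒮] [Nonempty 𝒮] [MeasurableSpace 𝒮] [MeasurableSingletonClass 𝒮]
    [Fintype 𝒯] [Nonempty 𝒯] [MeasurableSpace 𝒯] [MeasurableSingletonClass 𝒯]
    [Fintype 𝒦] [Nonempty 𝒦] [MeasurableSpace 𝒦] [MeasurableSingletonClass 𝒦]
    [Fintype 𝒲] [Nonempty 𝒲] [MeasurableSpace 𝒲] [MeasurableSingletonClass 𝒲]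
    [Fintype 𝒰] [Nonempty 𝒰] [MeasurableSpace 𝒰] [MeasurableSingletonClass 𝒰]
    [Fintype 𝒵₂] [Nonempty 𝒵₂] [MeasurableSpace 𝒵₂] [MeasurableSingletonClass 𝒵₂]
    [Fintype 𝒴₁₁] [Nonempty 𝒴₁₁] [MeasurableSpace 𝒴₁₁] [MeasurableSingletonClass 𝒴₁₁]
    [Fintype 𝒴₁₂] [Nonempty 𝒴₁₂] [MeasurableSpace 𝒴₁₂] [MeasurableSingletonClass 𝒴₁₂]
    (μ : MeasureTheory.Measure Ω) [MeasureTheory.IsProbabilityMeasure μ]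
    (S : Ω → 𝒮)
    (T : Ω → 𝒯)
    (K : Ω → 𝒦)
    (W : Ω → 𝒲)
    (U : Ω → 𝒰)
    (Yh₂ : Ω → 𝒵₂)
    (Y₁₁ : Ω → 𝒴₁₁)
    (Y₁₂ : Ω → 𝒴₁₂)
    (hS : Measurable S)
    (hT : Measurable T)
    (hK : Measurable K)
    (hW : Measurable W)
    (hU : Measurable U)
    (hYh₂ : Measurable Yh₂)
    (hY₁₁ : Measurable Y₁₁)
    (hY₁₂ : Measurable Y₁₂)
    (α : 𝒮 → 𝒦) (β : 𝒯 → 𝒦)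
    (hKα : ∀ᵐ ω ∂μ, K ω = α (S ω)) (hKβ : ∀ᵐ ω ∂μ, K ω = β (T ω))
    (ρ₀ ρ₁ r₂ : ℝ) (hr₂ : 0 ≤ r₂)
    (h1 : cI μ (p2 S T) W K < ρ₀)
    (h2 : cI μ T U (p2 S W) < ρ₁)
    (h3 : cH μ S (p2 K W) + H μ K ≤ I μ (p3 S U W) (p3 Yh₂ Y₁₁ Y₁₂) - r₂ - ρ₀ - ρ₁) :
    H μ S < I μ (p3 S W U) (p3 Yh₂ Y₁₁ Y₁₂) - cI μ T (p2 W U) S := by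
  have hSTK : H μ (p2 (p2 S T) K) = H μ (p2 S T) :=
    H_eq_of_ae_eq_comp (fun x => (x, α x.1)) (fun x y h => (Prod.ext_iff.1 h).1) <| by
      filter_upwards [hKα] with ω hω
      simp [p2, hω]
  have hSTWK : H μ (p2 (p2 S T) (p2 W K)) = H μ (p2 T (p2 S W)) :=
    H_eq_of_ae_eq_comp (fun x => ((x.2.1, x.1), (x.2.2, α x.2.1)))
      (fun x y h => by simp_all [Prod.ext_iff]) <| by
      filter_upwards [hKα] with ω hω
      simp [p2, hω]
  have hSKW : H μ (p2 S (p2 K W)) = H μ (p2 S W) :=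
    H_eq_of_ae_eq_comp (fun x => (x.1, (α x.1, x.2)))
      (fun x y h => by simp_all [Prod.ext_iff]) <| by
      filter_upwards [hKα] with ω hω
      simp [p2, hω]
  have hWK : H μ (p2 W K) = H μ (p2 K W) :=
    H_eq_of_ae_eq_comp Prod.swap Prod.swap_injective (.of_forall fun _ => rfl)
  have hTS : H μ (p2 T S) = H μ (p2 S T) :=
    H_eq_of_ae_eq_comp Prod.swap Prod.swap_injective (.of_forall fun _ => rfl)
  have hWUS : H μ (p2 (p2 W U) S) = H μ (p2 U (p2 S W)) :=
    H_eq_of_ae_eq_comp (fun x => ((x.2.2, x.1), x.2.1))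
      (fun x y h => by simp_all [Prod.ext_iff]) (.of_forall fun _ => rfl)
  have hTWUS : H μ (p2 T (p2 (p2 W U) S)) = H μ (p2 T (p2 U (p2 S W))) :=
    H_eq_of_ae_eq_comp (fun x => (x.1, ((x.2.2.2, x.2.1), x.2.2.1)))
      (fun x y h => by simp_all [Prod.ext_iff]) (.of_forall fun _ => rfl)
  have hSWU : H μ (p3 S W U) = H μ (p3 S U W) :=
    H_eq_of_ae_eq_comp (fun x => (x.1, x.2.2, x.2.1))
      (fun x y h => by simp_all [Prod.ext_iff]) (.of_forall fun _ => rfl)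
  have hSWUY : H μ (p2 (p3 S W U) (p3 Yh₂ Y₁₁ Y₁₂)) = H μ (p2 (p3 S U W) (p3 Yh₂ Y₁₁ Y₁₂)) :=
    H_eq_of_ae_eq_comp (fun x => ((x.1.1, x.1.2.2, x.1.2.1), x.2))
      (fun x y h => by simp_all [Prod.ext_iff]) (.of_forall fun _ => rfl)
  unfold cI at h1 h2 ⊢
  unfold cH at h3
  unfold I at h3 ⊢
  linarith
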